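/- arXiv:math/0007107 — 2 statements merged into one kernel-verified Lean document; each statement's English description precedes it below -/
import Mathlib

section
/- Let γ be a permutation of Fin r and for each t ≥ 1 let n_t be the number of orbits of γ on Fin r of cardinality t (so fixed points are counted as cycles of length 1, and Σ_t t·n_t = r). Then the centralizer of γ in Perm(Fin r) is isomorphic as a group to the product over those t with n_t > 0 of the wreath products (ℤ/tℤ) ≀ S_{n_t}, i.e. of the semidirect products ((ℤ/tℤ)^{n_t}) ⋊ S_{n_t} where S_{n_t} = Perm(Fin n_t) acts by permuting the coordinates of (ℤ/tℤ)^{n_t}. -/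
/-- The coordinate-permutation action of `S_n = Perm (Fin n)` on `A^n = (Fin n → A)`,
as a homomorphism into the automorphism group. -/
def permMulAut (n : ℕ) (A : Type*) [Group A] :
    Equiv.Perm (Fin n) →* MulAut (Fin n → A) where
  toFun σ :=
    { toFun := fun f i => f (σ⁻¹ i)
      invFun := fun f i => f (σ i)
      left_inv := fun f => by ext i; simp
      right_inv := fun f => by ext i; simp
      map_mul' := fun f g => rfl }
  map_one' := by
    ext f i
    simp
  map_mul' := fun σ τ => by
    ext f i
    simp [mul_inv_rev]

/-- The wreath product `(ℤ/tℤ) ≀ S_n`, i.e. the semidirect product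
`((ℤ/tℤ)^n) ⋊ S_n` with `S_n` permuting the coordinates. -/
def Wreath (t n : ℕ) : Type :=
  SemidirectProduct (Fin n → Multiplicative (ZMod t)) (Equiv.Perm (Fin n))
    (permMulAut n (Multiplicative (ZMod t)))

noncomputable instance (t n : ℕ) : Group (Wreath t n) :=
  inferInstanceAs (Group (SemidirectProduct _ _ _))

/-- `numOrbits r γ t` is the number `n_t` of orbits of the cyclic group generated
by `γ` on `Fin r` having cardinality `t` (fixed points count as cycles of length 1). -/
noncomputable def numOrbits (r : ℕ) (γ : Equiv.Perm (Fin r)) (t : ℕ) : ℕ :=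
  Nat.card {o : MulAction.orbitRel.Quotient (Subgroup.zpowers γ) (Fin r) //
    Nat.card o.orbit = t}

namespace Wreath

variable {t n : ℕ}

theorem mul_left_apply (w w' : Wreath t n) (i : Fin n) :
    (w * w').left i = w.left i * w'.left (w.right⁻¹ i) := rfl

theorem mul_right (w w' : Wreath t n) : (w * w').right = w.right * w'.right := rfl

theorem one_left_apply (i : Fin n) : (1 : Wreath t n).left i = 1 := rfl

theorem one_right : (1 : Wreath t n).right = 1 := rfl

/-- The imprimitive action of `Wreath t n` on `Fin n × ZMod t`. -/
def act (w : Wreath t n) (x : Fin n × ZMod t) : Fin n × ZMod t :=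
  (w.right x.1, (w.left (w.right x.1)).toAdd + x.2)

/-- The element of `Wreath t n` acting by `(i, a) ↦ (σ i, v i + a)`. -/
def ofPerm (σ : Equiv.Perm (Fin n)) (v : Fin n → ZMod t) : Wreath t n :=
  ⟨fun i => .ofAdd (v (σ⁻¹ i)), σ⟩

theorem act_ofPerm (σ : Equiv.Perm (Fin n)) (v : Fin n → ZMod t) (x : Fin n × ZMod t) :
    (ofPerm σ v).act x = (σ x.1, v x.1 + x.2) := by
  simp [act, ofPerm]

theorem act_one (x : Fin n × ZMod t) : act 1 x = x := by
  simp [act, one_left_apply, one_right]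

theorem act_mul (w w' : Wreath t n) (x : Fin n × ZMod t) :
    act (w * w') x = act w (act w' x) := by
  simp [act, mul_left_apply, mul_right, add_assoc]

theorem act_injective : Function.Injective (act : Wreath t n → _) := by
  intro w w' h
  have hr : w.right = w'.right := by
    ext i
    simpa [act] using congrArg (fun x => (x.1 : ℕ)) (congrFun h (i, 0))
  refine SemidirectProduct.ext (funext fun i => ?_) hr
  have := congrArg Prod.snd (congrFun h (w.right⁻¹ i, 0))
  simpa [act, ← hr] using this

end Wreath

section CycleModel

variable {T : Type*} (p n : T → ℕ)

/-- A disjoint union of cycles, with `n t` cycles of length `p t` for each `t`. -/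
abbrev CycleModel : Type _ := Σ t, Fin (n t) × ZMod (p t)

/-- The permutation rotating every cycle by one step. -/
def cycleShift : Equiv.Perm (CycleModel p n) where
  toFun x := ⟨x.1, x.2.1, x.2.2 + 1⟩
  invFun x := ⟨x.1, x.2.1, x.2.2 - 1⟩
  left_inv x := by simp
  right_inv x := by simp

/-- The product of the wreath products acts on the disjoint union of cycles. -/
noncomputable def wreathPerm : (∀ t, Wreath (p t) (n t)) →* Equiv.Perm (CycleModel p n) :=
  MonoidHom.toHomPerm
    { toFun := fun w x => ⟨x.1, (w x.1).act x.2⟩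
      map_one' := funext fun x => congrArg (Sigma.mk x.1) (Wreath.act_one x.2)
      map_mul' := fun _ _ => funext fun x => congrArg (Sigma.mk x.1) (Wreath.act_mul _ _ x.2) }

variable {p n}

theorem wreathPerm_apply (w : ∀ t, Wreath (p t) (n t)) (t : T) (x : Fin (n t) × ZMod (p t)) :
    wreathPerm p n w ⟨t, x⟩ = ⟨t, (w t).act x⟩ := rfl

theorem wreathPerm_injective : Function.Injective (wreathPerm p n) := by
  intro w w' h
  funext t
  refine Wreath.act_injective (funext fun x => ?_)
  have := DFunLike.congr_fun h ⟨t, x⟩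
  simpa [wreathPerm_apply] using this

theorem cycleShift_zpow_apply (k : ℤ) (t : T) (i : Fin (n t)) (a : ZMod (p t)) :
    (cycleShift p n ^ k) ⟨t, i, a⟩ = ⟨t, i, a + k⟩ := by
  induction k with
  | zero => simp
  | succ k ih =>
    rw [add_comm, zpow_add, Equiv.Perm.mul_apply, ih]
    simp [cycleShift, add_assoc, add_comm]
  | pred k ih =>
    rw [sub_eq_add_neg, add_comm, zpow_add, Equiv.Perm.mul_apply, ih, zpow_neg_one,
      Equiv.Perm.inv_def]
    simp [cycleShift, sub_eq_add_neg, add_assoc, add_comm]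

theorem cycleShift_zpow_apply_eq_self_iff (k : ℤ) (x : CycleModel p n) :
    (cycleShift p n ^ k) x = x ↔ (p x.1 : ℤ) ∣ k := by
  obtain ⟨t, i, a⟩ := x
  rw [cycleShift_zpow_apply]
  simp [ZMod.intCast_zmod_eq_zero_iff_dvd]

theorem fst_apply_of_commute (hp : Function.Injective p) {f : Equiv.Perm (CycleModel p n)}
    (hf : Commute f (cycleShift p n)) (x : CycleModel p n) : (f x).1 = x.1 := by
  have key (k : ℤ) : (p (f x).1 : ℤ) ∣ k ↔ (p x.1 : ℤ) ∣ k := by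
    rw [← cycleShift_zpow_apply_eq_self_iff, ← cycleShift_zpow_apply_eq_self_iff,
      ← Equiv.Perm.mul_apply, ← (hf.zpow_right k).eq, Equiv.Perm.mul_apply, f.injective.eq_iff]
  apply hp
  apply Nat.dvd_antisymm
  · exact_mod_cast (key (p x.1)).2 dvd_rfl
  · exact_mod_cast (key (p (f x).1)).1 dvd_rfl

theorem exists_apply_of_commute (hp : Function.Injective p) {f : Equiv.Perm (CycleModel p n)}
    (hf : Commute f (cycleShift p n)) (t : T) (i : Fin (n t)) :
    ∃ y : Fin (n t) × ZMod (p t), ∀ a, f ⟨t, i, a⟩ = ⟨t, y.1, y.2 + a⟩ := by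
  obtain ⟨s, y, hy⟩ : ∃ s y, f ⟨t, i, 0⟩ = ⟨s, y⟩ := ⟨_, _, rfl⟩
  obtain rfl : s = t := by simpa [hy] using fst_apply_of_commute hp hf ⟨t, i, 0⟩
  refine ⟨y, fun a => ?_⟩
  obtain ⟨k, rfl⟩ := ZMod.intCast_surjective a
  have := DFunLike.congr_fun (hf.zpow_right k).eq ⟨s, i, 0⟩
  rw [Equiv.Perm.mul_apply, Equiv.Perm.mul_apply, cycleShift_zpow_apply, hy,
    cycleShift_zpow_apply] at this
  simpa using this

theorem range_wreathPerm (hp : Function.Injective p) :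
    (wreathPerm p n).range = Subgroup.centralizer {cycleShift p n} := by
  ext f
  rw [Subgroup.mem_centralizer_singleton_iff, MonoidHom.mem_range]
  constructor
  · rintro ⟨w, rfl⟩
    refine Equiv.ext fun ⟨t, i, a⟩ => ?_
    simp [wreathPerm_apply, cycleShift, Wreath.act]
    exact (add_assoc _ _ _).symm
  · intro hf
    choose y hy using exists_apply_of_commute hp (show Commute f _ from hf)
    choose z hz using exists_apply_of_commute hp
      (show Commute f⁻¹ _ from (show Commute f _ from hf).inv_left)
    let σ (t : T) : Equiv.Perm (Fin (n t)) :=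
      { toFun := fun i => (y t i).1
        invFun := fun i => (z t i).1
        left_inv := fun i => by
          have := f.symm_apply_apply ⟨t, i, 0⟩
          rw [← Equiv.Perm.inv_def, hy, hz] at this
          simp at this
          exact this.1
        right_inv := fun i => by
          have := f.apply_symm_apply ⟨t, i, 0⟩
          rw [← Equiv.Perm.inv_def, hz, hy] at this
          simp at this
          exact this.1 }
    refine ⟨fun t => .ofPerm (σ t) fun i => (y t i).2, Equiv.ext ?_⟩
    rintro ⟨t, i, a⟩
    rw [wreathPerm_apply, hy, Wreath.act_ofPerm]
    rfl

/-- A permutation conjugate to `cycleShift p n` has the product of wreath products as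
centralizer. -/
theorem nonempty_centralizer_mulEquiv {α : Type*} (hp : Function.Injective p)
    (e : CycleModel p n ≃ α) {γ : Equiv.Perm α} (he : ∀ x, e (cycleShift p n x) = γ (e x)) :
    Nonempty (Subgroup.centralizer {γ} ≃* ∀ t, Wreath (p t) (n t)) := by
  have hγ : e.permCongrHom (cycleShift p n) = γ := by
    ext x
    simp [Equiv.permCongrHom, Equiv.permCongr_apply, he]
  let E := (wreathPerm p n).ofInjective wreathPerm_injective
  refine ⟨(E.trans ((MulEquiv.subgroupCongr (range_wreathPerm hp)).trans
    ((e.permCongrHom.subgroupMap _).trans (MulEquiv.subgroupCongr ?_)))).symm⟩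
  ext f
  change f ∈ Subgroup.map e.permCongrHom.toMonoidHom _ ↔ _
  rw [Subgroup.mem_map_equiv, Subgroup.mem_centralizer_singleton_iff,
    Subgroup.mem_centralizer_singleton_iff, ← e.permCongrHom.injective.eq_iff]
  rw [map_mul, map_mul, hγ, MulEquiv.apply_symm_apply]

end CycleModel

open MulAction

section Orbits

variable {r : ℕ} (γ : Equiv.Perm (Fin r))

theorem zpow_apply_eq_zpow_apply_iff {α : Type*} (γ : Equiv.Perm α) (x : α) (k l : ℤ) :
    (γ ^ k) x = (γ ^ l) x ↔
      (k : ZMod (Nat.card (orbit (Subgroup.zpowers γ) x))) = l := by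
  rw [Nat.card_congr (orbitZPowersEquiv γ x), Nat.card_zmod,
    ZMod.intCast_eq_intCast_iff_dvd_sub, ← zpow_smul_eq_iff_minimalPeriod_dvd,
    Equiv.Perm.smul_def, sub_eq_neg_add, zpow_add, zpow_neg, Equiv.Perm.mul_apply,
    Equiv.Perm.inv_eq_iff_eq, eq_comm]

/-- An enumeration of the orbits of `γ` of cardinality `t`. -/
noncomputable def orbitEnum (t : ℕ) : Fin (numOrbits r γ t) ≃
    {o : orbitRel.Quotient (Subgroup.zpowers γ) (Fin r) // Nat.card o.orbit = t} :=
  (Finite.equivFin _).symm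

/-- The parametrization of `Fin r` by the cycles of `γ`. -/
noncomputable def cycleParam
    (x : CycleModel (fun t : {t : ℕ // 0 < numOrbits r γ t} => t.1)
      (fun t => numOrbits r γ t.1)) : Fin r :=
  (γ ^ (x.2.2.cast : ℤ)) (orbitEnum γ x.1 x.2.1).1.out

theorem card_orbit_out {t : ℕ}
    (o : {o : orbitRel.Quotient (Subgroup.zpowers γ) (Fin r) // Nat.card o.orbit = t}) :
    Nat.card (orbit (Subgroup.zpowers γ) o.1.out) = t := by
  rw [← orbitRel.Quotient.orbit_eq_orbit_out o.1 Quotient.out_eq', o.2]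

theorem zpow_out_eq_zpow_out_iff {t : ℕ}
    (o : {o : orbitRel.Quotient (Subgroup.zpowers γ) (Fin r) // Nat.card o.orbit = t})
    (k l : ℤ) : (γ ^ k) o.1.out = (γ ^ l) o.1.out ↔ (k : ZMod t) = l := by
  rw [zpow_apply_eq_zpow_apply_iff, card_orbit_out]

theorem mk_zpow_out (o : orbitRel.Quotient (Subgroup.zpowers γ) (Fin r)) (k : ℤ) :
    (Quotient.mk'' ((γ ^ k) o.out) : orbitRel.Quotient (Subgroup.zpowers γ) (Fin r)) = o := by
  conv_rhs => rw [← Quotient.out_eq' o]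
  exact Quotient.sound' ⟨⟨γ ^ k, k, rfl⟩, rfl⟩

theorem cycleParam_cycleShift (x) : cycleParam γ (cycleShift _ _ x) = γ (cycleParam γ x) := by
  obtain ⟨t, i, a⟩ := x
  have h : (((a + 1 : ZMod t.1).cast : ℤ) : ZMod t.1) =
      ((1 + (ZMod.cast (a : ZMod t.1) : ℤ) : ℤ) : ZMod t.1) := by
    simp [add_comm]
  rw [cycleParam, cycleParam, ← Equiv.Perm.mul_apply, ← zpow_one_add]
  exact (zpow_out_eq_zpow_out_iff γ _ _ _).2 h

theorem cycleParam_injective : Function.Injective (cycleParam γ) := by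
  rintro ⟨⟨t, ht⟩, i, a⟩ ⟨⟨s, hs⟩, j, b⟩ h
  have ho : (orbitEnum γ t i).1 = (orbitEnum γ s j).1 := by
    simpa [cycleParam, mk_zpow_out] using congrArg (Quotient.mk'' : Fin r →
      orbitRel.Quotient (Subgroup.zpowers γ) (Fin r)) h
  obtain rfl : t = s := by rw [← (orbitEnum γ t i).2, ho, (orbitEnum γ s j).2]
  obtain rfl : i = j := (orbitEnum γ t).injective (Subtype.ext ho)
  have : a = b := by simpa using (zpow_out_eq_zpow_out_iff γ _ _ _).1 h
  rw [this]

theorem cycleParam_surjective : Function.Surjective (cycleParam γ) := by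
  intro x
  let o : orbitRel.Quotient (Subgroup.zpowers γ) (Fin r) := Quotient.mk'' x
  let o' : {q : orbitRel.Quotient (Subgroup.zpowers γ) (Fin r) //
    Nat.card q.orbit = Nat.card (orbitRel.Quotient.orbit o)} := ⟨o, rfl⟩
  obtain ⟨⟨_, k, rfl⟩, hk⟩ : x ∈ orbit (Subgroup.zpowers γ) o.out :=
    orbitRel.Quotient.orbit_eq_orbit_out o Quotient.out_eq' ▸ orbitRel.Quotient.mem_orbit.2 rfl
  have hpos : 0 < numOrbits r γ (Nat.card (orbitRel.Quotient.orbit o)) := by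
    exact Nat.card_pos_iff.2 ⟨⟨o'⟩, inferInstance⟩
  refine ⟨⟨⟨_, hpos⟩, (orbitEnum γ _).symm o', k⟩, ?_⟩
  rw [← hk, cycleParam]
  simp only [Equiv.apply_symm_apply]
  exact (zpow_out_eq_zpow_out_iff γ o' _ _).2 (ZMod.intCast_zmod_cast _)

end Orbits

/-- The centralizer of `γ` in `Perm (Fin r)` is isomorphic to the product, over
those `t` with `n_t > 0`, of the wreath products `(ℤ/tℤ) ≀ S_{n_t}`. -/
theorem centralizer_iso_prod_wreath (r : ℕ) (γ : Equiv.Perm (Fin r)) :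
    Nonempty ((Subgroup.centralizer {γ}) ≃*
      ((t : {t : ℕ // 0 < numOrbits r γ t}) → Wreath t.1 (numOrbits r γ t.1))) := by
  exact nonempty_centralizer_mulEquiv Subtype.val_injective
    (Equiv.ofBijective _ ⟨cycleParam_injective γ, cycleParam_surjective γ⟩)
    (cycleParam_cycleShift γ)
end

section
/- Let γ be a permutation of Fin r and for each t ≥ 1 let n_t be the number of orbits of γ on Fin r of cardinality t. Let D^γ denote the fixed-point set of γ in (ℂˣ)^r under the coordinate-permutation action, and let the centralizer Z(γ) of γ in Perm(Fin r) act on D^γ by restriction of the coordinate-permutation action. Then the orbit space D^γ / Z(γ) is in bijection with the product, over those t with n_t > 0, of the symmetric products Sym^{n_t}(ℂˣ). -/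
/-- The fixed-point set `D^γ` of `γ` in `(ℂˣ)^r` under the coordinate-permutation
action `(γ • f) i = f (γ⁻¹ i)`. -/
def FixedPts (r : ℕ) (γ : Equiv.Perm (Fin r)) : Type :=
  {f : Fin r → ℂˣ // ∀ i, f (γ⁻¹ i) = f i}

/-- Two functions on a finite type have the same multiset of values if and only if they differ by
a permutation of the source. -/
theorem map_univ_val_eq_iff_exists_perm {ι A : Type*} [Fintype ι] (F G : ι → A) :
    (Finset.univ : Finset ι).val.map F = (Finset.univ : Finset ι).val.map G ↔
      ∃ e : Equiv.Perm ι, ∀ i, G (e i) = F i := by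
  classical
  constructor
  · intro h
    have hcard (a : A) : Nonempty ({i // F i = a} ≃ {i // G i = a}) := by
      have hc := congrArg (Multiset.count a) h
      rw [Multiset.count_map, Multiset.count_map] at hc
      refine ⟨Fintype.equivOfCardEq ?_⟩
      rw [Fintype.card_subtype, Fintype.card_subtype]
      simpa [Finset.card_def, Finset.filter_val, eq_comm] using hc
    exact ⟨Equiv.ofFiberEquiv fun a => (hcard a).some,
      fun i => Equiv.ofFiberEquiv_map _ i⟩
  · rintro ⟨e, he⟩
    rw [← funext he]
    conv_rhs => rw [← Multiset.map_univ_val_equiv e, Multiset.map_map]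
    rfl

/-- Every multiset with as many elements as a finite type is the multiset of values of a function
on that type. -/
theorem exists_map_univ_val_eq {ι A : Type*} [Fintype ι] (s : Multiset A)
    (hs : s.card = Fintype.card ι) :
    ∃ F : ι → A, (Finset.univ : Finset ι).val.map F = s := by
  classical
  have e : ι ≃ s := Fintype.equivOfCardEq (by rw [Multiset.card_coe, hs])
  refine ⟨fun i => (e i).1, ?_⟩
  conv_rhs => rw [← Multiset.map_univ_coe s, ← Multiset.map_univ_val_equiv e, Multiset.map_map]
  rfl

namespace Equiv.Perm

variable {X : Type*} {γ : Equiv.Perm X}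

/-- The set of orbits of the cyclic group generated by a permutation. -/
abbrev Orbits (γ : Equiv.Perm X) : Type _ :=
  MulAction.orbitRel.Quotient (Subgroup.zpowers γ) X

/-- The orbit of a point under the cyclic group generated by `γ`. -/
abbrev toOrbits (γ : Equiv.Perm X) (x : X) : γ.Orbits :=
  Quotient.mk (MulAction.orbitRel (Subgroup.zpowers γ) X) x

theorem toOrbits_eq_iff {x y : X} : γ.toOrbits x = γ.toOrbits y ↔ ∃ k : ℤ, (γ ^ k) y = x := by
  rw [Quotient.eq, MulAction.orbitRel_apply, MulAction.mem_orbit_iff]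
  simp [Subgroup.smul_def]

theorem toOrbits_zpow_apply (k : ℤ) (x : X) : γ.toOrbits ((γ ^ k) x) = γ.toOrbits x :=
  toOrbits_eq_iff.2 ⟨k, rfl⟩

theorem zpow_apply_eq_zpow_apply_iff [Finite X] (x : X) (k l : ℤ) :
    (γ ^ k) x = (γ ^ l) x ↔ (Nat.card (γ.toOrbits x).orbit : ℤ) ∣ k - l := by
  have := Fintype.ofFinite (MulAction.orbit (Subgroup.zpowers γ) x)
  rw [MulAction.orbitRel.Quotient.orbit_mk, Nat.card_eq_fintype_card,
    ← MulAction.minimalPeriod_eq_card, ← MulAction.zpow_smul_eq_iff_minimalPeriod_dvd,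
    Equiv.Perm.smul_def, sub_eq_neg_add, zpow_add, Equiv.Perm.mul_apply, zpow_neg,
    Equiv.Perm.inv_eq_iff_eq]

/-- A size-preserving self-map of the orbits of `γ` lifts to a self-map of the underlying type which
is compatible with the powers of `γ` on the chosen orbit representatives. -/
theorem exists_map_zpow_out [Finite X] (e : γ.Orbits → γ.Orbits)
    (he : ∀ o, Nat.card (e o).orbit = Nat.card o.orbit) :
    ∃ φ : X → X, ∀ (o : γ.Orbits) (k : ℤ), φ ((γ ^ k) o.out) = (γ ^ k) (e o).out := by
  have hrep (x : X) : ∃ k : ℤ, (γ ^ k) (γ.toOrbits x).out = x :=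
    toOrbits_eq_iff.1 (Quotient.out_eq _).symm
  choose κ hκ using hrep
  refine ⟨fun x => (γ ^ κ x) (e (γ.toOrbits x)).out, fun o k => ?_⟩
  have ho : γ.toOrbits ((γ ^ k) o.out) = o :=
    (toOrbits_zpow_apply k _).trans (Quotient.out_eq o)
  have h := hκ ((γ ^ k) o.out)
  rw [ho, zpow_apply_eq_zpow_apply_iff, toOrbits, Quotient.out_eq] at h
  beta_reduce
  rwa [ho, zpow_apply_eq_zpow_apply_iff, toOrbits, Quotient.out_eq, he]

/-- A size-preserving permutation of the orbits of `γ` is induced by a permutation commuting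
with `γ`. -/
theorem exists_commute_toOrbits_apply [Finite X] (e : Equiv.Perm γ.Orbits)
    (he : ∀ o, Nat.card (e o).orbit = Nat.card o.orbit) :
    ∃ σ : Equiv.Perm X, Commute σ γ ∧ ∀ x, γ.toOrbits (σ x) = e (γ.toOrbits x) := by
  obtain ⟨φ, hφ⟩ := exists_map_zpow_out e he
  obtain ⟨ψ, hψ⟩ := exists_map_zpow_out e.symm fun o => by simpa using (he (e.symm o)).symm
  have hrep (x : X) : ∃ (o : γ.Orbits) (k : ℤ), (γ ^ k) o.out = x :=
    ⟨γ.toOrbits x, toOrbits_eq_iff.1 (Quotient.out_eq _).symm⟩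
  refine ⟨⟨φ, ψ, fun x => ?_, fun x => ?_⟩, Equiv.ext fun x => ?_, fun x => ?_⟩ <;>
    obtain ⟨o, k, rfl⟩ := hrep x
  · rw [hφ, hψ, e.symm_apply_apply]
  · rw [hψ, hφ, e.apply_symm_apply]
  · change φ (γ ((γ ^ k) o.out)) = γ (φ ((γ ^ k) o.out))
    rw [← Equiv.Perm.mul_apply, ← zpow_one_add, hφ, hφ, zpow_one_add, Equiv.Perm.mul_apply]
  · change γ.toOrbits (φ ((γ ^ k) o.out)) = _
    rw [hφ, toOrbits_zpow_apply, toOrbits_zpow_apply, toOrbits, toOrbits, Quotient.out_eq,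
      Quotient.out_eq]

/-- A permutation commuting with `γ` induces a size-preserving permutation of the orbits of `γ`. -/
theorem exists_perm_orbits_of_commute {σ : Equiv.Perm X} (hσ : Commute σ γ) :
    ∃ e : Equiv.Perm γ.Orbits, (∀ o, Nat.card (e o).orbit = Nat.card o.orbit) ∧
      ∀ x, e (γ.toOrbits x) = γ.toOrbits (σ x) := by
  have hcomm (k : ℤ) (x : X) : (γ ^ k) (σ x) = σ ((γ ^ k) x) :=
    (Equiv.congr_fun (hσ.zpow_right k).eq x).symm
  have hrel (x y : X) :
      γ.toOrbits (σ x) = γ.toOrbits (σ y) ↔ γ.toOrbits x = γ.toOrbits y := by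
    simp only [toOrbits_eq_iff, hcomm, σ.injective.eq_iff]
  refine ⟨Quotient.congr σ fun x y => by
    rw [← Quotient.eq (r := MulAction.orbitRel _ X), ← Quotient.eq (r := MulAction.orbitRel _ X)]
    exact (hrel x y).symm, fun o => ?_, fun x => rfl⟩
  induction o using Quotient.inductionOn with
  | h x =>
    refine (Nat.card_congr (σ.subtypeEquiv fun y => ?_)).symm
    rw [MulAction.orbitRel.Quotient.mem_orbit, MulAction.orbitRel.Quotient.mem_orbit]
    exact (hrel y x).symm

end Equiv.Perm

namespace FixedPts

variable {r : ℕ} {γ : Equiv.Perm (Fin r)}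

theorem apply_zpow (f : FixedPts r γ) (k : ℤ) (i : Fin r) : f.1 ((γ ^ k) i) = f.1 i := by
  have h (j : Fin r) : f.1 (γ j) = f.1 j := by simpa using (f.2 (γ j)).symm
  induction k using Int.induction_on generalizing i with
  | zero => rfl
  | succ n ih => rw [zpow_add_one, Equiv.Perm.mul_apply, ih, h]
  | pred n ih => rw [zpow_sub_one, Equiv.Perm.mul_apply, ih, f.2]

/-- Points fixed by `γ` are the same as functions on the set of orbits of `γ`. -/
def equivOrbits (γ : Equiv.Perm (Fin r)) : FixedPts r γ ≃ (γ.Orbits → ℂˣ) where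
  toFun f := Quotient.lift f.1 fun x y h => by
    obtain ⟨k, rfl⟩ := Equiv.Perm.toOrbits_eq_iff.1 (Quotient.sound h)
    exact f.apply_zpow k y
  invFun F := ⟨fun i => F (γ.toOrbits i), fun i =>
    congrArg F (by simpa using Equiv.Perm.toOrbits_zpow_apply (-1) i)⟩
  left_inv f := rfl
  right_inv F := funext fun o => Quotient.inductionOn o fun _ => rfl

theorem equivOrbits_toOrbits (f : FixedPts r γ) (i : Fin r) :
    equivOrbits γ f (γ.toOrbits i) = f.1 i := rfl

theorem exists_centralizer_iff_exists_perm_orbits (f g : FixedPts r γ) :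
    (∃ σ ∈ Subgroup.centralizer {γ}, ∀ i, f.1 (σ⁻¹ i) = g.1 i) ↔
      ∃ e : Equiv.Perm γ.Orbits, (∀ o, Nat.card (e o).orbit = Nat.card o.orbit) ∧
        ∀ o, equivOrbits γ g (e o) = equivOrbits γ f o := by
  constructor
  · rintro ⟨σ, hσ, h⟩
    obtain ⟨e, he, heσ⟩ := Equiv.Perm.exists_perm_orbits_of_commute (γ := γ) (σ := σ)
      (Subgroup.mem_centralizer_singleton_iff.1 hσ)
    refine ⟨e, he, fun o => Quotient.inductionOn o fun i => ?_⟩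
    rw [heσ, equivOrbits_toOrbits, equivOrbits_toOrbits, ← h]
    exact congrArg f.1 (σ.symm_apply_apply i)
  · rintro ⟨e, he, h⟩
    obtain ⟨σ, hσ, hσe⟩ := Equiv.Perm.exists_commute_toOrbits_apply e he
    refine ⟨σ, Subgroup.mem_centralizer_singleton_iff.2 hσ, fun i => ?_⟩
    rw [← equivOrbits_toOrbits, ← h, ← hσe, Equiv.Perm.inv_def,
      Equiv.apply_symm_apply, equivOrbits_toOrbits]

open Classical in
/-- The multisets of values of a point fixed by `γ` on the orbits of each given size. -/
noncomputable def orbitValues (f : FixedPts r γ) (t : ℕ) : Sym ℂˣ (numOrbits r γ t) :=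
  ⟨(Finset.univ : Finset {o : γ.Orbits // Nat.card o.orbit = t}).val.map
      fun o => equivOrbits γ f o.1, by
    rw [Multiset.card_map, numOrbits, Nat.card_eq_fintype_card]; rfl⟩

theorem val_orbitValues (f : FixedPts r γ) (t : ℕ)
    [Fintype {o : γ.Orbits // Nat.card o.orbit = t}] :
    (f.orbitValues t).1 =
      (Finset.univ : Finset {o : γ.Orbits // Nat.card o.orbit = t}).val.map
        fun o => equivOrbits γ f o.1 := by
  rw [orbitValues]
  congr!

theorem isEmpty_of_numOrbits_eq_zero {t : ℕ} (ht : ¬ 0 < numOrbits r γ t) :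
    IsEmpty {o : γ.Orbits // Nat.card o.orbit = t} :=
  Finite.card_eq_zero_iff.1 (Nat.eq_zero_of_not_pos ht)

theorem orbitValues_eq_iff (f g : FixedPts r γ) :
    (∀ t : {t : ℕ // 0 < numOrbits r γ t}, f.orbitValues t = g.orbitValues t) ↔
      ∃ σ ∈ Subgroup.centralizer {γ}, ∀ i, f.1 (σ⁻¹ i) = g.1 i := by
  classical
  rw [exists_centralizer_iff_exists_perm_orbits]
  constructor
  · intro h
    have hfib (t : ℕ) : ∃ e : Equiv.Perm {o : γ.Orbits // Nat.card o.orbit = t},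
        ∀ o, equivOrbits γ g (e o).1 = equivOrbits γ f o.1 := by
      by_cases ht : 0 < numOrbits r γ t
      · have hv := congrArg Subtype.val (h ⟨t, ht⟩)
        rw [val_orbitValues, val_orbitValues] at hv
        exact (map_univ_val_eq_iff_exists_perm _ _).1 hv
      · have := isEmpty_of_numOrbits_eq_zero ht
        exact ⟨1, isEmptyElim⟩
    choose e he using hfib
    exact ⟨Equiv.ofFiberEquiv e, fun o => Equiv.ofFiberEquiv_map e o,
      fun o => he (Nat.card o.orbit) ⟨o, rfl⟩⟩
  · rintro ⟨e, he, h⟩ t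
    apply Subtype.ext
    rw [val_orbitValues, val_orbitValues]
    exact (map_univ_val_eq_iff_exists_perm _ _).2 ⟨e.subtypeEquiv fun o => by rw [he], fun o => h o.1⟩

theorem exists_orbitValues_eq (S : (t : {t : ℕ // 0 < numOrbits r γ t}) →
    Sym ℂˣ (numOrbits r γ t.1)) : ∃ f : FixedPts r γ, ∀ t, f.orbitValues t.1 = S t := by
  classical
  have hS (t : {t : ℕ // 0 < numOrbits r γ t}) :=
    exists_map_univ_val_eq (ι := {o : γ.Orbits // Nat.card o.orbit = t.1}) (S t).1 (by
      rw [(S t).2, numOrbits, Nat.card_eq_fintype_card])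
  choose F hF using hS
  have hpos (o : γ.Orbits) : 0 < numOrbits r γ (Nat.card o.orbit) := by
    by_contra ho
    exact (isEmpty_of_numOrbits_eq_zero ho).false ⟨o, rfl⟩
  refine ⟨(equivOrbits γ).symm fun o => F ⟨_, hpos o⟩ ⟨o, rfl⟩, fun t => Subtype.ext ?_⟩
  rw [← hF t, val_orbitValues]
  refine Multiset.map_congr rfl fun ⟨o, ho⟩ _ => ?_
  rw [Equiv.apply_symm_apply]
  obtain ⟨t, ht⟩ := t
  change Nat.card o.orbit = t at ho
  subst ho
  rfl

end FixedPts

/-- The orbit space `D^γ / Z(γ)` of the fixed-point set of `γ` in `(ℂˣ)^r` under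
the restricted coordinate-permutation action of the centralizer `Z(γ)` of `γ`
in `Perm (Fin r)` is in bijection with the product, over those `t` with `n_t > 0`,
of the symmetric products `Sym^{n_t}(ℂˣ)`. -/
theorem fixedPts_mod_centralizer_equiv_prod_sym (r : ℕ) (γ : Equiv.Perm (Fin r)) :
    Nonempty ((Quot fun f g : FixedPts r γ =>
        ∃ σ ∈ Subgroup.centralizer {γ}, ∀ i, f.1 (σ⁻¹ i) = g.1 i) ≃
      ((t : {t : ℕ // 0 < numOrbits r γ t}) → Sym ℂˣ (numOrbits r γ t.1))) := by
  refine ⟨Equiv.ofBijective (Quot.lift (fun f t => f.orbitValues t.1) fun f g h =>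
    funext ((FixedPts.orbitValues_eq_iff f g).2 h)) ⟨?_, fun S => ?_⟩⟩
  · rintro ⟨f⟩ ⟨g⟩ h
    exact Quot.sound ((FixedPts.orbitValues_eq_iff f g).1 (congrFun h))
  · obtain ⟨f, hf⟩ := FixedPts.exists_orbitValues_eq S
    exact ⟨Quot.mk _ f, funext hf⟩
end
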